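/- arXiv:2507.01762 — 6 statements merged into one kernel-verified Lean document; each statement's English description precedes it below -/
import Mathlib

section
/- Let τ be a nondegenerate, positively oriented triangle in ℝ² with vertices x0, x1, x2, and regard the radius ratio μ = R/(2r) = p·q/(16|τ|²) as a function of x0 with x1, x2 fixed. Then ∇_{x0} μ = μ·[ (1/(p l1) + 1/l1²)(x0 − x2) + (1/(p l2) + 1/l2²)(x0 − x1) + (1/|τ|) W (x1 − x2) ]. -/
noncomputable section

/-- The Euclidean plane. -/
abbrev E2 := EuclideanSpace ℝ (Fin 2)

/-- Signed area of the triangle `(a, b, c)`: `½ det(b − a, c − a)`. -/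
def sarea (a b c : E2) : ℝ :=
  (1/2) * ((b - a) 0 * (c - a) 1 - (b - a) 1 * (c - a) 0)

/-- `R` is the circumradius of the triangle `(a, b, c)`:
the radius of a circle passing through all three vertices. -/
def IsCircumradius2 (a b c : E2) (R : ℝ) : Prop :=
  ∃ z : E2, dist z a = R ∧ dist z b = R ∧ dist z c = R

/-- `r` is the inradius of the triangle `(a, b, c)`: the radius of a circle whose center lies
in the triangle and which is tangent to (i.e. at distance `r` from) the lines through all
three sides. -/
def IsInradius2 (a b c : E2) (r : ℝ) : Prop :=
  ∃ z : E2, z ∈ convexHull ℝ {a, b, c} ∧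
    Metric.infDist z (affineSpan ℝ {b, c} : Set E2) = r ∧
    Metric.infDist z (affineSpan ℝ {c, a} : Set E2) = r ∧
    Metric.infDist z (affineSpan ℝ {a, b} : Set E2) = r

/-- The 90°-rotation matrix `W = ((0, −1), (1, 0))`. -/
def Wmat : Matrix (Fin 2) (Fin 2) ℝ := !![0, -1; 1, 0]

/-- Apply a `2 × 2` real matrix to a vector of `ℝ²`. -/
def mulVec2 (M : Matrix (Fin 2) (Fin 2) ℝ) (v : E2) : E2 :=
  (WithLp.equiv 2 (Fin 2 → ℝ)).symm (M.mulVec (WithLp.equiv 2 (Fin 2 → ℝ) v))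

/-- The radius ratio `μ = R/(2r) = p·q/(16|τ|²)` of the triangle `(a, b, c)`, expressed
through edge lengths and signed area. -/
def ratio2 (a b c : E2) : ℝ :=
  ((‖c - b‖ + ‖a - c‖ + ‖b - a‖) * (‖c - b‖ * ‖a - c‖ * ‖b - a‖)) /
    (16 * (sarea a b c) ^ 2)

/-- The gradient of the distance to `c` is the unit vector pointing away from `c`. -/
theorem hasGradientAt_norm_sub {c x : E2} (h : x ≠ c) :
    HasGradientAt (fun y : E2 => ‖y - c‖) ((1 / ‖x - c‖) • (x - c)) x := by
  rw [hasGradientAt_iff_hasFDerivAt]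
  have hne : ‖x - c‖ ≠ 0 := norm_ne_zero_iff.2 (sub_ne_zero.2 h)
  have key := (((hasFDerivAt_id x).sub_const c).norm_sq).sqrt (pow_ne_zero 2 hne)
  simp only [id, Real.sqrt_sq (norm_nonneg _)] at key
  refine key.congr_fderiv ?_
  ext v
  simp
  field_simp

/-- The gradient of the signed area with respect to the first vertex. -/
theorem hasGradientAt_sarea (a b c : E2) :
    HasGradientAt (fun y : E2 => sarea y b c) (-(1 / 2 : ℝ) • mulVec2 Wmat (b - c)) a := by
  rw [hasGradientAt_iff_hasFDerivAt]
  have h (d : E2) (i : Fin 2) := ((EuclideanSpace.proj (𝕜 := ℝ) i).hasFDerivAt).comp a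
    ((hasFDerivAt_id a).const_sub d)
  refine ((((h b 0).mul (h c 1)).sub ((h b 1).mul (h c 0))).const_mul (1 / 2)).congr_fderiv ?_
  ext v
  simp [mulVec2, Wmat, PiLp.inner_apply, Fin.sum_univ_two, dotProduct]
  ring

/-- For a nondegenerate, positively oriented triangle with vertices `x0, x1, x2` in `ℝ²`,
the gradient of the radius ratio `μ = p·q/(16|τ|²)`, regarded as a function of `x0`, is
`∇_{x0} μ = μ [ (1/(p l1) + 1/l1²)(x0 − x2) + (1/(p l2) + 1/l2²)(x0 − x1)
              + (1/|τ|) W (x1 − x2) ]`. -/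
theorem gradient_radius_ratio
    (x0 x1 x2 : E2)
    (hnd : AffineIndependent ℝ ![x0, x1, x2])
    (hpos : 0 < sarea x0 x1 x2)
    (l1 l2 p : ℝ)
    (hl1 : l1 = ‖x0 - x2‖) (hl2 : l2 = ‖x1 - x0‖)
    (hp : p = ‖x2 - x1‖ + ‖x0 - x2‖ + ‖x1 - x0‖) :
    gradient (fun x : E2 => ratio2 x x1 x2) x0 =
      ratio2 x0 x1 x2 •
        ((1 / (p * l1) + 1 / l1 ^ 2) • (x0 - x2) +
         (1 / (p * l2) + 1 / l2 ^ 2) • (x0 - x1) +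
         (1 / sarea x0 x1 x2) • mulVec2 Wmat (x1 - x2)) := by
  have h02 : x0 ≠ x2 := fun h => by simpa using hnd.injective.ne (a₁ := 0) (a₂ := 2) (by decide) h
  have h01 : x0 ≠ x1 := fun h => by simpa using hnd.injective.ne (a₁ := 0) (a₂ := 1) (by decide) h
  have hl1pos : 0 < l1 := hl1 ▸ norm_pos_iff.2 (sub_ne_zero.2 h02)
  have hl2pos : 0 < l2 := hl2 ▸ norm_pos_iff.2 (sub_ne_zero.2 h01.symm)
  have d1 := (hasGradientAt_norm_sub h02).hasFDerivAt
  have d2 := (hasGradientAt_norm_sub h01).hasFDerivAt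
  have dS := (hasGradientAt_sarea x0 x1 x2).hasFDerivAt
  simp only [norm_sub_rev _ x1] at d2
  rw [← hl1] at d1
  rw [← hl2] at d2
  have hp_pos : 0 < p := by rw [hp, ← hl1, ← hl2]; positivity
  refine HasGradientAt.gradient ?_
  rw [hasGradientAt_iff_hasFDerivAt]
  have key := (((d1.const_add ‖x2 - x1‖).add d2).mul ((d1.const_mul ‖x2 - x1‖).mul d2)).mul
    ((hasDerivAt_inv (by positivity)).comp_hasFDerivAt x0 ((dS.pow 2).const_mul 16))
  refine (key.congr_fderiv ?_)
  ext v
  simp [ratio2, ← hl1, ← hl2]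
  have hp' : ‖x2 - x1‖ = p - l1 - l2 := by rw [hp, ← hl1, ← hl2]; ring
  rw [hp']
  have := hpos.ne'
  field_simp
  ring
end
end

section
/- For a nondegenerate, positively oriented tetrahedron τ in ℝ³ with vertices x0, x1, x2, x3, the circumradius satisfies R = ‖d0‖ / (12|τ|), where d0 = ‖v30‖²(v10 × v20) + ‖v10‖²(v20 × v30) + ‖v20‖²(v30 × v10), v10 = x0 − x1, v20 = x0 − x2, v30 = x0 − x3, and |τ| is the volume of τ. -/
noncomputable section

/-- Euclidean three-space. -/
abbrev E3 := EuclideanSpace ℝ (Fin 3)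

/-- The cross product on `ℝ³`. -/
def cross (a b : E3) : E3 :=
  (WithLp.equiv 2 (Fin 3 → ℝ)).symm
    ![a 1 * b 2 - a 2 * b 1, a 2 * b 0 - a 0 * b 2, a 0 * b 1 - a 1 * b 0]

/-- The dot product on `ℝ³`. -/
def dot (a b : E3) : ℝ := a 0 * b 0 + a 1 * b 1 + a 2 * b 2

/-- Signed volume of the tetrahedron `(a, b, c, d)`:
`(1/6) det(b − a, c − a, d − a)`. -/
def svol (a b c d : E3) : ℝ := (1/6) * dot (b - a) (cross (c - a) (d - a))

/-- Area of the triangle `(a, b, c)` in `ℝ³`. -/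
def triArea (a b c : E3) : ℝ := (1/2) * ‖cross (b - a) (c - a)‖

/-- Total surface area of the tetrahedron `(a, b, c, d)`: the sum of the areas of the four
triangular faces (the face opposite each vertex). -/
def sTot (a b c d : E3) : ℝ :=
  triArea b c d + triArea a c d + triArea a b d + triArea a b c

/-- The vector `d0 = ‖v30‖²(v10 × v20) + ‖v10‖²(v20 × v30) + ‖v20‖²(v30 × v10)` of the
tetrahedron `(a, b, c, d)`, where `v10 = a − b`, `v20 = a − c`, `v30 = a − d`. -/
def d0vec (a b c d : E3) : E3 :=
  ‖a - d‖ ^ 2 • cross (a - b) (a - c) + ‖a - b‖ ^ 2 • cross (a - c) (a - d) +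
    ‖a - c‖ ^ 2 • cross (a - d) (a - b)

/-- `R` is the circumradius of the tetrahedron `(a, b, c, d)`: the radius of a sphere
through the four vertices. -/
def IsCircumradius3 (a b c d : E3) (R : ℝ) : Prop :=
  ∃ z : E3, dist z a = R ∧ dist z b = R ∧ dist z c = R ∧ dist z d = R

/-- `r` is the inradius of the tetrahedron `(a, b, c, d)`: the radius of a sphere whose
center lies in the tetrahedron and which is tangent to (i.e. at distance `r` from) the
planes of all four faces. -/
def IsInradius3 (a b c d : E3) (r : ℝ) : Prop :=
  ∃ z : E3, z ∈ convexHull ℝ {a, b, c, d} ∧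
    Metric.infDist z (affineSpan ℝ {b, c, d} : Set E3) = r ∧
    Metric.infDist z (affineSpan ℝ {a, c, d} : Set E3) = r ∧
    Metric.infDist z (affineSpan ℝ {a, b, d} : Set E3) = r ∧
    Metric.infDist z (affineSpan ℝ {a, b, c} : Set E3) = r

/-- If `z` is equidistant from `a` and `b`, then `a - z` projects orthogonally onto `a - b` as half of it. -/
theorem norm_sub_sq_eq_two_mul_dot_of_dist_eq {z a b : E3} (h : dist z a = dist z b) :
    ‖a - b‖ ^ 2 = 2 * dot (a - z) (a - b) := by
  have hsq : ‖z - a‖ ^ 2 = ‖z - b‖ ^ 2 := by rw [← dist_eq_norm, ← dist_eq_norm, h]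
  simp only [EuclideanSpace.norm_sq_eq, Fin.sum_univ_three, Real.norm_eq_abs, sq_abs, dot,
    PiLp.sub_apply] at hsq ⊢
  linarith

/-- A point equidistant from the vertices of a tetrahedron `(a, b, c, d)` satisfies
`d0 = 12 |τ| (z - a)`. -/
theorem d0vec_eq_smul_of_dist_eq {z a b c d : E3} (hb : dist z a = dist z b)
    (hc : dist z a = dist z c) (hd : dist z a = dist z d) :
    d0vec a b c d = (12 * svol a b c d) • (z - a) := by
  rw [d0vec, norm_sub_sq_eq_two_mul_dot_of_dist_eq hb, norm_sub_sq_eq_two_mul_dot_of_dist_eq hc,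
    norm_sub_sq_eq_two_mul_dot_of_dist_eq hd]
  ext i
  fin_cases i <;>
  · simp [svol, dot, cross]
    ring

/-- For a nondegenerate, positively oriented tetrahedron with vertices `x0, x1, x2, x3`
in `ℝ³`, the circumradius satisfies `R = ‖d0‖ / (12 |τ|)`. -/
theorem circumradius_eq_norm_d0_div_twelve_vol
    (x0 x1 x2 x3 : E3) (R : ℝ)
    (hnd : AffineIndependent ℝ ![x0, x1, x2, x3])
    (hpos : 0 < svol x0 x1 x2 x3)
    (hR : IsCircumradius3 x0 x1 x2 x3 R) :
    R = ‖d0vec x0 x1 x2 x3‖ / (12 * svol x0 x1 x2 x3) := by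
  obtain ⟨z, ha, hb, hc, hd⟩ := hR
  rw [d0vec_eq_smul_of_dist_eq (ha.trans hb.symm) (ha.trans hc.symm) (ha.trans hd.symm),
    norm_smul, ← dist_eq_norm, ha, Real.norm_of_nonneg (by positivity)]
  field_simp
end
end

section
/- For a nondegenerate, positively oriented tetrahedron τ in ℝ³ with vertices x0, x1, x2, x3, the radius ratio satisfies μ = R/(3r) = s·‖d0‖ / (108|τ|²), where R is the circumradius, r the inradius, s the total surface area, |τ| the volume, and d0 = ‖v30‖²(v10 × v20) + ‖v10‖²(v20 × v30) + ‖v20‖²(v30 × v10) with v10 = x0 − x1, v20 = x0 − x2, v30 = x0 − x3. -/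
noncomputable section

@[simp]
theorem cross_apply_zero (a b : E3) : cross a b 0 = a 1 * b 2 - a 2 * b 1 := rfl

@[simp]
theorem cross_apply_one (a b : E3) : cross a b 1 = a 2 * b 0 - a 0 * b 2 := rfl

@[simp]
theorem cross_apply_two (a b : E3) : cross a b 2 = a 0 * b 1 - a 1 * b 0 := rfl

theorem dot_eq_inner (a b : E3) : dot a b = inner ℝ a b := by
  simp only [dot, PiLp.inner_apply, Fin.sum_univ_three, RCLike.inner_apply, conj_trivial]
  ring

theorem dot_self_eq_norm_sq (a : E3) : dot a a = ‖a‖ ^ 2 := by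
  rw [dot_eq_inner, real_inner_self_eq_norm_sq]

theorem dot_add_left (a b c : E3) : dot (a + b) c = dot a c + dot b c := by
  simp only [dot_eq_inner, inner_add_left]

theorem dot_sub_left (a b c : E3) : dot (a - b) c = dot a c - dot b c := by
  simp only [dot_eq_inner, inner_sub_left]

theorem dot_smul_left (t : ℝ) (a b : E3) : dot (t • a) b = t * dot a b := by
  simp only [dot_eq_inner, real_inner_smul_left]

theorem abs_dot_le (a b : E3) : |dot a b| ≤ ‖a‖ * ‖b‖ := by
  rw [dot_eq_inner]
  exact abs_real_inner_le_norm a b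

theorem dot_cross_self_left (u v : E3) : dot u (cross u v) = 0 := by
  simp only [dot, cross_apply_zero, cross_apply_one, cross_apply_two]
  ring

theorem dot_cross_self_right (u v : E3) : dot v (cross u v) = 0 := by
  simp only [dot, cross_apply_zero, cross_apply_one, cross_apply_two]
  ring

/-- Decomposition of a vector along `u`, `v` and the normal `cross u v`. -/
theorem norm_cross_sq_smul (u v w : E3) :
    ‖cross u v‖ ^ 2 • w = dot w (cross u v) • cross u v +
      (dot (cross w v) (cross u v) • u + dot (cross u w) (cross u v) • v) := by
  rw [← dot_self_eq_norm_sq]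
  ext i
  fin_cases i <;>
    simp [dot] <;> ring

/-- Cramer's rule in `ℝ³`: a vector is determined by its dot products with three vectors. -/
theorem dot_cross_smul (u v t w : E3) :
    dot u (cross v t) • w =
      dot w t • cross u v + dot w u • cross v t + dot w v • cross t u := by
  ext i
  fin_cases i <;>
    simp [dot] <;> ring

theorem dot_sub_cross_eq_zero_of_mem_affineSpan {p q s y : E3}
    (hy : y ∈ affineSpan ℝ {p, q, s}) :
    dot (y - p) (cross (q - p) (s - p)) = 0 := by
  refine affineSpan_induction (p := fun y => dot (y - p) (cross (q - p) (s - p)) = 0) hy ?_ ?_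
  · rintro x (rfl | rfl | rfl)
    · simp [dot]
    · exact dot_cross_self_left _ _
    · exact dot_cross_self_right _ _
  · intro c u v w hu hv hw
    rw [vsub_eq_sub, vadd_eq_add, show c • (u - v) + w - p =
      c • ((u - p) - (v - p)) + (w - p) by module, dot_add_left, dot_smul_left, dot_sub_left,
      hu, hv, hw]
    ring

/-- The distance from a point to the plane through `p`, `q`, `s`, in terms of the normal vector
`cross (q - p) (s - p)`. -/
theorem infDist_affineSpan_mul_norm_cross (x p q s : E3) :
    Metric.infDist x (affineSpan ℝ {p, q, s} : Set E3) * ‖cross (q - p) (s - p)‖ =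
      |dot (x - p) (cross (q - p) (s - p))| := by
  set n := cross (q - p) (s - p) with hn
  have hp : p ∈ affineSpan ℝ {p, q, s} := subset_affineSpan ℝ _ (by simp)
  have hq : q ∈ affineSpan ℝ {p, q, s} := subset_affineSpan ℝ _ (by simp)
  have hs : s ∈ affineSpan ℝ {p, q, s} := subset_affineSpan ℝ _ (by simp)
  rcases (norm_nonneg n).eq_or_lt with h0 | h0
  · have hle := abs_dot_le (x - p) n
    rw [← h0, mul_zero] at hle ⊢
    exact (le_antisymm hle (abs_nonneg _)).symm
  apply le_antisymm
  · rw [← le_div_iff₀ h0]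
    set m : E3 := (dot (x - p) n / ‖n‖ ^ 2) • n with hm
    have hmem : x - m ∈ affineSpan ℝ {p, q, s} := by
      have hdir : (dot (cross (x - p) (s - p)) n / ‖n‖ ^ 2) • (q - p) +
          (dot (cross (q - p) (x - p)) n / ‖n‖ ^ 2) • (s - p) ∈
            (affineSpan ℝ {p, q, s}).direction :=
        add_mem (Submodule.smul_mem _ _ (AffineSubspace.vsub_mem_direction hq hp))
          (Submodule.smul_mem _ _ (AffineSubspace.vsub_mem_direction hs hp))
      have hdecomp := congrArg (fun y => (‖n‖ ^ 2)⁻¹ • y)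
        (norm_cross_sq_smul (q - p) (s - p) (x - p))
      simp only [← hn, smul_add, smul_smul, inv_mul_cancel₀ (pow_pos h0 2).ne', one_smul] at hdecomp
      convert AffineSubspace.vadd_mem_of_mem_direction hdir hp using 1
      rw [vadd_eq_add, hm, ← sub_eq_iff_eq_add, sub_right_comm, sub_eq_iff_eq_add']
      simpa only [div_eq_inv_mul] using hdecomp
    refine (Metric.infDist_le_dist_of_mem hmem).trans_eq ?_
    rw [dist_eq_norm, sub_sub_cancel, hm, norm_smul, Real.norm_eq_abs, abs_div, abs_pow, abs_norm]
    field_simp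
  · rw [← div_le_iff₀ h0, Metric.le_infDist ⟨p, hp⟩]
    intro y hy
    rw [div_le_iff₀ h0, dist_eq_norm]
    have hxy : dot (x - p) n = dot (x - y) n := by
      rw [← sub_add_sub_cancel x y p, dot_add_left,
        dot_sub_cross_eq_zero_of_mem_affineSpan hy, add_zero]
    rw [hxy]
    exact abs_dot_le _ _

theorem dot_sub_nonneg_of_mem_convexHull {S : Set E3} {p n : E3}
    (hS : ∀ x ∈ S, 0 ≤ dot (x - p) n) {z : E3} (hz : z ∈ convexHull ℝ S) :
    0 ≤ dot (z - p) n := by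
  refine convexHull_min (t := {x : E3 | 0 ≤ dot (x - p) n}) hS ?_ hz
  intro x hx y hy α β hα hβ hαβ
  rw [Set.mem_ofPred_eq] at hx hy ⊢
  obtain rfl : β = 1 - α := by linarith
  rw [show α • x + (1 - α) • y - p = α • (x - p) + (1 - α) • (y - p) by module,
    dot_add_left, dot_smul_left, dot_smul_left]
  positivity

/-- The circumradius formula `‖d0‖ = 12 |τ| R`. -/
theorem IsCircumradius3.norm_d0vec {a b c d : E3} {R : ℝ} (h : IsCircumradius3 a b c d R)
    (hpos : 0 < svol a b c d) : ‖d0vec a b c d‖ = 12 * svol a b c d * R := by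
  obtain ⟨z, ha, hb, hc, hd⟩ := h
  have key (x : E3) (hx : dist z x = R) : ‖a - x‖ ^ 2 = 2 * dot (a - z) (a - x) := by
    have h1 : ‖a - z‖ ^ 2 = ‖(a - z) - (a - x)‖ ^ 2 := by
      rw [sub_sub_sub_cancel_left, ← dist_eq_norm, ← dist_eq_norm, dist_comm a z, ha,
        dist_comm x z, hx]
    rw [norm_sub_sq_real (a - z), ← dot_eq_inner] at h1
    linarith
  have hd0 : d0vec a b c d = (-(12 * svol a b c d)) • (a - z) := by
    have hcramer := dot_cross_smul (a - b) (a - c) (a - d) (a - z)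
    have hvol : dot (a - b) (cross (a - c) (a - d)) = -(6 * svol a b c d) := by
      simp only [svol, dot, cross_apply_zero, cross_apply_one, cross_apply_two, PiLp.sub_apply]
      ring
    rw [hvol] at hcramer
    rw [d0vec, key b hb, key c hc, key d hd, show (-(12 * svol a b c d)) • (a - z) =
      (2 : ℝ) • ((-(6 * svol a b c d)) • (a - z)) by module, hcramer]
    module
  rw [hd0, norm_smul, norm_neg, ← dist_eq_norm, dist_comm, ha, Real.norm_of_nonneg (by positivity)]

/-- The inradius formula `r s = 3 |τ|`. -/
theorem IsInradius3.mul_sTot {a b c d : E3} {r : ℝ} (h : IsInradius3 a b c d r)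
    (hpos : 0 < svol a b c d) : r * sTot a b c d = 3 * svol a b c d := by
  obtain ⟨z, hz, ha, hb, hc, hd⟩ := h
  have ea := infDist_affineSpan_mul_norm_cross z b c d
  have eb := infDist_affineSpan_mul_norm_cross z a c d
  have ec := infDist_affineSpan_mul_norm_cross z a b d
  have ed := infDist_affineSpan_mul_norm_cross z a b c
  have na : 0 ≤ dot (z - b) (-cross (c - b) (d - b)) := by
    refine dot_sub_nonneg_of_mem_convexHull ?_ hz
    rintro x (rfl | rfl | rfl | rfl) <;> simp [dot, svol] at hpos ⊢ <;> linarith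
  have nb : 0 ≤ dot (z - a) (cross (c - a) (d - a)) := by
    refine dot_sub_nonneg_of_mem_convexHull ?_ hz
    rintro x (rfl | rfl | rfl | rfl) <;> simp [dot, svol] at hpos ⊢ <;> linarith
  have nc : 0 ≤ dot (z - a) (-cross (b - a) (d - a)) := by
    refine dot_sub_nonneg_of_mem_convexHull ?_ hz
    rintro x (rfl | rfl | rfl | rfl) <;> simp [dot, svol] at hpos ⊢ <;> linarith
  have nd : 0 ≤ dot (z - a) (cross (b - a) (c - a)) := by
    refine dot_sub_nonneg_of_mem_convexHull ?_ hz
    rintro x (rfl | rfl | rfl | rfl) <;> simp [dot, svol] at hpos ⊢ <;> linarith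
  have dot_neg (u v : E3) : dot u (-v) = -dot u v := by simp only [dot_eq_inner, inner_neg_right]
  rw [dot_neg] at na nc
  rw [ha, abs_of_nonpos (by linarith)] at ea
  rw [hb, abs_of_nonneg nb] at eb
  rw [hc, abs_of_nonpos (by linarith)] at ec
  rw [hd, abs_of_nonneg nd] at ed
  have hsum : -dot (z - b) (cross (c - b) (d - b)) + dot (z - a) (cross (c - a) (d - a)) +
      -dot (z - a) (cross (b - a) (d - a)) + dot (z - a) (cross (b - a) (c - a)) =
        6 * svol a b c d := by
    simp only [svol, dot, cross_apply_zero, cross_apply_one, cross_apply_two, PiLp.sub_apply]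
    ring
  rw [sTot, triArea, triArea, triArea, triArea]
  linarith

/-- For a nondegenerate, positively oriented tetrahedron with vertices `x0, x1, x2, x3`
in `ℝ³`, the radius ratio satisfies `μ = R/(3r) = s ‖d0‖ / (108 |τ|²)`. -/
theorem radius_ratio_eq_tet
    (x0 x1 x2 x3 : E3) (R r : ℝ)
    (hnd : AffineIndependent ℝ ![x0, x1, x2, x3])
    (hpos : 0 < svol x0 x1 x2 x3)
    (hR : IsCircumradius3 x0 x1 x2 x3 R)
    (hr : IsInradius3 x0 x1 x2 x3 r) :
    R / (3 * r) =
      (sTot x0 x1 x2 x3 * ‖d0vec x0 x1 x2 x3‖) / (108 * (svol x0 x1 x2 x3) ^ 2) := by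
  have hd0 := hR.norm_d0vec hpos
  have hrs := hr.mul_sTot hpos
  have hr0 : r ≠ 0 := by
    rintro rfl
    linarith
  have hv0 := hpos.ne'
  rw [hd0, div_eq_div_iff (by positivity) (by positivity)]
  linear_combination (-36 * svol x0 x1 x2 x3 * R) * hrs
end
end

section
/- Let x0, x1, x2, x3 ∈ ℝ³ be the vertices of a nondegenerate tetrahedron, and regard ‖d0‖, with d0 = ‖v30‖²(v10 × v20) + ‖v10‖²(v20 × v30) + ‖v20‖²(v30 × v10), as a function of x0 with x1, x2, x3 fixed. If d0 ≠ 0, then ∇_{x0}‖d0‖ = (1/‖d0‖)·{ 2[ (d0·(v20 × v30)) v10 + (d0·(v30 × v10)) v20 + (d0·(v10 × v20)) v30 ] + d0 × [ (‖v30‖² − ‖v20‖²) v10 + (‖v10‖² − ‖v30‖²) v20 + (‖v20‖² − ‖v10‖²) v30 ] }. -/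
noncomputable section

/-- The cross product as a continuous bilinear map. -/
def crossL : E3 →L[ℝ] E3 →L[ℝ] E3 :=
  LinearMap.toContinuousBilinearMap (LinearMap.mk₂ ℝ cross
    (fun a b c => by ext i; fin_cases i <;> simp [cross] <;> ring)
    (fun r a b => by ext i; fin_cases i <;> simp [cross] <;> ring)
    (fun a b c => by ext i; fin_cases i <;> simp [cross] <;> ring)
    (fun r a b => by ext i; fin_cases i <;> simp [cross] <;> ring))

lemma crossL_apply (a b : E3) : crossL a b = cross a b := rfl

lemma HasFDerivAt.cross {f g : E3 → E3} {f' g' : E3 →L[ℝ] E3} {x : E3}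
    (hf : HasFDerivAt f f' x) (hg : HasFDerivAt g g' x) :
    HasFDerivAt (fun y => cross (f y) (g y))
      (crossL.precompR E3 (f x) g' + crossL.precompL E3 f' (g x)) x :=
  crossL.hasFDerivAt_of_bilinear hf hg

lemma exists_hasFDerivAt_d0vec (x x1 x2 x3 : E3) :
    ∃ D : E3 →L[ℝ] E3, HasFDerivAt (fun y => d0vec y x1 x2 x3) D x ∧ ∀ h, D h =
      ‖x - x3‖ ^ 2 • (cross (x - x1) h + cross h (x - x2)) +
        (2 * inner ℝ (x - x3) h) • cross (x - x1) (x - x2) +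
      (‖x - x1‖ ^ 2 • (cross (x - x2) h + cross h (x - x3)) +
        (2 * inner ℝ (x - x1) h) • cross (x - x2) (x - x3)) +
      (‖x - x2‖ ^ 2 • (cross (x - x3) h + cross h (x - x1)) +
        (2 * inner ℝ (x - x2) h) • cross (x - x3) (x - x1)) := by
  have hsub (c : E3) : HasFDerivAt (fun y : E3 => y - c) (.id ℝ E3) x :=
    (hasFDerivAt_id x).sub_const c
  refine ⟨_, (((hsub x3).norm_sq.smul ((hsub x1).cross (hsub x2))).add
    ((hsub x1).norm_sq.smul ((hsub x2).cross (hsub x3)))).add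
    ((hsub x2).norm_sq.smul ((hsub x3).cross (hsub x1))), fun h => ?_⟩
  simp [crossL_apply, -map_sub]

lemma inner_eq_dot (a b : E3) : inner ℝ a b = dot a b := by
  simp [PiLp.inner_apply, Fin.sum_univ_three, dot, mul_comm]

lemma inner_d0vec_derivative (d a b c h : E3) (p q r : ℝ) :
    inner ℝ d (r • (cross a h + cross h b) + (2 * inner ℝ c h) • cross a b +
      (p • (cross b h + cross h c) + (2 * inner ℝ a h) • cross b c) +
      (q • (cross c h + cross h a) + (2 * inner ℝ b h) • cross c a)) =
    inner ℝ ((2 : ℝ) • (dot d (cross b c) • a + dot d (cross c a) • b + dot d (cross a b) • c) +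
      cross d ((r - q) • a + (p - r) • b + (q - p) • c)) h := by
  simp only [inner_eq_dot]
  simp [dot, cross]
  ring

/-- For a nondegenerate tetrahedron with vertices `x0, x1, x2, x3` in `ℝ³` with `d0 ≠ 0`,
the gradient of `‖d0‖`, regarded as a function of `x0`, is
`∇_{x0}‖d0‖ = (1/‖d0‖)·{ 2[(d0·(v20×v30))v10 + (d0·(v30×v10))v20 + (d0·(v10×v20))v30]
  + d0 × [(‖v30‖² − ‖v20‖²)v10 + (‖v10‖² − ‖v30‖²)v20 + (‖v20‖² − ‖v10‖²)v30] }`. -/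
theorem gradient_norm_d0
    (x0 x1 x2 x3 : E3)
    (hnd : AffineIndependent ℝ ![x0, x1, x2, x3])
    (v10 v20 v30 d0 : E3)
    (hv10 : v10 = x0 - x1) (hv20 : v20 = x0 - x2) (hv30 : v30 = x0 - x3)
    (hd0 : d0 = d0vec x0 x1 x2 x3) (hne : d0 ≠ 0) :
    gradient (fun x : E3 => ‖d0vec x x1 x2 x3‖) x0 =
      (1 / ‖d0‖) •
        ((2 : ℝ) • (dot d0 (cross v20 v30) • v10 + dot d0 (cross v30 v10) • v20 +
            dot d0 (cross v10 v20) • v30) +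
          cross d0 ((‖v30‖ ^ 2 - ‖v20‖ ^ 2) • v10 + (‖v10‖ ^ 2 - ‖v30‖ ^ 2) • v20 +
            (‖v20‖ ^ 2 - ‖v10‖ ^ 2) • v30)) := by
  subst hv10 hv20 hv30
  obtain ⟨D, hD, hDapply⟩ := exists_hasFDerivAt_d0vec x0 x1 x2 x3
  have hpos : 0 < ‖d0‖ := norm_pos_iff.mpr hne
  have hnorm := hD.norm_sq.sqrt (by rw [← hd0]; positivity)
  simp only [Real.sqrt_sq (norm_nonneg _), ← hd0] at hnorm
  apply HasGradientAt.gradient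
  rw [hasGradientAt_iff_hasFDerivAt]
  refine hnorm.congr_fderiv ?_
  ext h
  rw [InnerProductSpace.toDual_apply_apply, real_inner_smul_left, ← inner_d0vec_derivative,
    ← hDapply]
  simp
  field_simp
end
end

section
/- Let P be a real symmetric n×n matrix that is weakly diagonally dominant with nonnegative diagonal, i.e. P_ii ≥ ∑_{j ≠ i} |P_ij| for every i, with strict inequality for at least one row i, and suppose P is irreducible (the directed graph on {1,…,n} with an edge from i to j whenever P_ij ≠ 0 is strongly connected). Then P is positive definite. -/
noncomputable section

open Finset Matrix in
/-- Twice the quadratic form of a symmetric matrix, with the diagonal slack separated from the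
contributions of the pairs of distinct indices. -/
theorem Matrix.IsSymm.two_mul_dotProduct_mulVec_eq_sum {ι : Type*} [Fintype ι] [DecidableEq ι]
    {P : Matrix ι ι ℝ} (hP : P.IsSymm) (x : ι → ℝ) :
    2 * (x ⬝ᵥ P *ᵥ x) =
      ∑ i, (2 * (P i i - ∑ j ∈ univ.erase i, |P i j|) * x i ^ 2 +
        ∑ j ∈ univ.erase i, (|P i j| * (x i ^ 2 + x j ^ 2) + 2 * P i j * x i * x j)) := by
  have swap : ∑ i, ∑ j ∈ univ.erase i, |P i j| * x j ^ 2 =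
      ∑ i, ∑ j ∈ univ.erase i, |P i j| * x i ^ 2 := by
    rw [sum_comm' (t' := univ) (s' := fun i => univ.erase i) (by simp [eq_comm])]
    simp only [hP.apply]
  have form : x ⬝ᵥ P *ᵥ x = ∑ i, (P i i * x i ^ 2 + ∑ j ∈ univ.erase i, P i j * x i * x j) := by
    simp only [dotProduct, mulVec, mul_sum]
    refine sum_congr rfl fun i _ => ?_
    rw [← add_sum_erase _ _ (mem_univ i)]
    congr 1
    · ring
    · exact sum_congr rfl fun j _ => by ring
  have row (i : ι) : 2 * (P i i - ∑ j ∈ univ.erase i, |P i j|) * x i ^ 2 +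
      ∑ j ∈ univ.erase i, (|P i j| * (x i ^ 2 + x j ^ 2) + 2 * P i j * x i * x j) =
      2 * (P i i * x i ^ 2 + ∑ j ∈ univ.erase i, P i j * x i * x j) +
        (∑ j ∈ univ.erase i, |P i j| * x j ^ 2 - ∑ j ∈ univ.erase i, |P i j| * x i ^ 2) := by
    simp only [mul_add, sum_add_distrib, mul_assoc, ← mul_sum, ← sum_mul]
    ring
  rw [sum_congr rfl fun i _ => row i, sum_add_distrib, sum_sub_distrib, swap, sub_self, add_zero,
    form, mul_sum]

theorem abs_mul_sq_add_sq_add_nonneg (p a b : ℝ) :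
    0 ≤ |p| * (a ^ 2 + b ^ 2) + 2 * p * a * b := by
  rcases abs_cases p with ⟨h, hp⟩ | ⟨h, hp⟩ <;> rw [h]
  · nlinarith [mul_nonneg hp (sq_nonneg (a + b))]
  · nlinarith [mul_nonneg (neg_nonneg.2 hp.le) (sq_nonneg (a - b))]


/-- A real symmetric matrix that is weakly diagonally dominant (with nonnegative diagonal),
strictly diagonally dominant in at least one row, and irreducible (the directed graph with
an edge `i → j` whenever `P i j ≠ 0` is strongly connected) is positive definite. -/
theorem posDef_of_irreducible_diagonally_dominant
    (n : ℕ) (hn : 0 < n)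
    (P : Matrix (Fin n) (Fin n) ℝ)
    (hsym : P.IsSymm)
    (hdom : ∀ i, ∑ j ∈ Finset.univ.erase i, |P i j| ≤ P i i)
    (hstrict : ∃ i, ∑ j ∈ Finset.univ.erase i, |P i j| < P i i)
    (hirr : ∀ i j : Fin n, Relation.ReflTransGen (fun a b => P a b ≠ 0) i j) :
    P.PosDef := by
  refine Matrix.PosDef.of_dotProduct_mulVec_pos (by rwa [Matrix.isHermitian_iff_isSymm])
    fun x hx => ?_
  rw [star_trivial]
  by_contra! hle
  have hpair (i j : Fin n) := abs_mul_sq_add_sq_add_nonneg (P i j) (x i) (x j)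
  have hdiag (i : Fin n) :
      0 ≤ 2 * (P i i - ∑ j ∈ Finset.univ.erase i, |P i j|) * x i ^ 2 :=
    mul_nonneg (mul_nonneg zero_le_two (sub_nonneg.2 (hdom i))) (sq_nonneg _)
  have hoff (i : Fin n) := Finset.sum_nonneg fun j (_ : j ∈ Finset.univ.erase i) => hpair i j
  have hform := hsym.two_mul_dotProduct_mulVec_eq_sum x
  have hzero := (Finset.sum_eq_zero_iff_of_nonneg fun i _ => add_nonneg (hdiag i) (hoff i)).1
    (le_antisymm (hform.symm.trans_le (by linarith))
      (Finset.sum_nonneg fun i _ => add_nonneg (hdiag i) (hoff i)))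
  obtain ⟨k, hk⟩ := hstrict
  have hxk : x k = 0 := by
    have h : 2 * (P k k - ∑ j ∈ Finset.univ.erase k, |P k j|) * x k ^ 2 = 0 := by
      linarith [hzero k (Finset.mem_univ k), hdiag k, hoff k]
    exact pow_eq_zero_iff two_ne_zero |>.1
      ((mul_eq_zero.1 h).resolve_left (mul_pos two_pos (sub_pos.2 hk)).ne')
  refine hx (funext fun i => ?_)
  induction hirr k i with
  | refl => exact hxk
  | @tail a b _ hab ha =>
    obtain rfl | hne := eq_or_ne b a
    · exact ha
    have hsum := (add_eq_zero_iff_of_nonneg (hdiag a) (hoff a)).1 (hzero a (Finset.mem_univ a))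
    have h := (Finset.sum_eq_zero_iff_of_nonneg fun j _ => hpair a j).1 hsum.2 b
      (Finset.mem_erase.2 ⟨hne, Finset.mem_univ b⟩)
    rw [Pi.zero_apply] at ha ⊢
    simpa [ha, hab] using h
end
end

section
/- For any nondegenerate tetrahedron τ in ℝ³ with circumradius R and inradius r, one has R ≥ 3r, i.e. the radius ratio μ = R/(3r) satisfies μ ≥ 1; moreover μ = 1 if and only if τ is regular (all six edges have equal length). -/
noncomputable section

open scoped RealInnerProductSpace

section Simplex

variable {ι V : Type*} [Fintype ι] [NormedAddCommGroup V] [InnerProductSpace ℝ V]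

/-- The gradient `g` of the `i`-th barycentric coordinate of an affinely independent family; its
norm converts distances to the opposite face into barycentric coordinates. -/
theorem AffineIndependent.exists_barycentric_gradient [Nontrivial ι] {x : ι → V}
    (hx : AffineIndependent ℝ x) (i : ι) :
    ∃ g : V, (∀ j ≠ i, ⟪g, x i - x j⟫ = 1) ∧ ∀ w : ι → ℝ, ∑ j, w j = 1 →
      Metric.infDist (∑ j, w j • x j) (affineSpan ℝ (x '' {i}ᶜ) : Set V) * ‖g‖ = |w i| := by
  obtain ⟨k, hk⟩ := exists_ne i
  set S := affineSpan ℝ (x '' {i}ᶜ) with hS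
  have mem_face : ∀ j ≠ i, x j ∈ S := fun j hj =>
    subset_affineSpan ℝ _ (Set.mem_image_of_mem x hj)
  have : Nonempty S := ⟨⟨x k, mem_face k hk⟩⟩
  have : FiniteDimensional ℝ S.direction :=
    finiteDimensional_direction_affineSpan_of_finite ℝ ((Set.toFinite _).image x)
  have hi : x i ∉ S := by simp [hS, hx]
  set f : V := ((EuclideanGeometry.orthogonalProjection S (x i) : S) : V)
  set n : V := x i - f with hn
  have hn0 : n ≠ 0 := by
    intro h
    exact hi (sub_eq_zero.mp h ▸ EuclideanGeometry.orthogonalProjection_mem _)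
  have norm_pos : 0 < ‖n‖ := norm_pos_iff.mpr hn0
  have orth : ∀ j ≠ i, ⟪n, f - x j⟫ = 0 := fun j hj =>
    (Submodule.mem_orthogonal' _ _).mp
      (EuclideanGeometry.vsub_orthogonalProjection_mem_direction_orthogonal S (x i)) _
      (S.vsub_mem_direction (EuclideanGeometry.orthogonalProjection_mem _) (mem_face j hj))
  refine ⟨(‖n‖ ^ 2)⁻¹ • n, fun j hj => ?_, fun w hw => ?_⟩
  · rw [← sub_add_sub_cancel (x i) f (x j), ← hn, real_inner_smul_left, inner_add_right,
      orth j hj, real_inner_self_eq_norm_sq]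
    field_simp
    simp
  · have proj : ((EuclideanGeometry.orthogonalProjection S (∑ j, w j • x j) : S) : V) =
        ∑ j, w j • ((EuclideanGeometry.orthogonalProjection S (x j) : S) : V) := by
      rw [← Finset.affineCombination_eq_linear_combination _ _ _ hw,
        ← Finset.affineCombination_eq_linear_combination _ _ _ hw]
      exact Finset.univ.map_affineCombination x w hw
        (S.subtype.comp (EuclideanGeometry.orthogonalProjection S).toAffineMap)
    have diff : ∑ j, w j • x j - EuclideanGeometry.orthogonalProjection S (∑ j, w j • x j) =
        w i • n := by
      rw [proj, ← Finset.sum_sub_distrib, Finset.sum_eq_single i]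
      · rw [← smul_sub]
      · intro j _ hj
        rw [EuclideanGeometry.orthogonalProjection_eq_self_iff.mpr (mem_face j hj), sub_self]
      · simp
    rw [← EuclideanGeometry.dist_orthogonalProjection_eq_infDist, dist_eq_norm, diff, norm_smul,
      norm_smul, norm_inv, norm_pow, norm_norm, Real.norm_eq_abs]
    field_simp

/-- In a simplex of full dimension, a vector orthogonal to all edges at a vertex vanishes. -/
theorem AffineIndependent.eq_zero_of_inner_edge_eq_zero [FiniteDimensional ℝ V] {x : ι → V}
    (hx : AffineIndependent ℝ x) (hd : Fintype.card ι = Module.finrank ℝ V + 1) {v : V} (i : ι)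
    (hv : ∀ j ≠ i, ⟪v, x i - x j⟫ = 0) : v = 0 := by
  have htop := hx.vectorSpan_eq_top_of_card_eq_finrank_add_one hd
  rw [vectorSpan_range_eq_span_range_vsub_left ℝ x i] at htop
  have : v ∈ (Submodule.span ℝ (Set.range fun j => x i -ᵥ x j))ᗮ := by
    rw [Submodule.mem_orthogonal']
    intro u hu
    induction hu using Submodule.span_induction with
    | mem u hu =>
      obtain ⟨j, rfl⟩ := hu
      by_cases h : j = i
      · simp [h]
      · exact hv j h
    | zero => simp
    | add a b _ _ ha hb => rw [inner_add_right, ha, hb, add_zero]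
    | smul c a _ ha => rw [real_inner_smul_right, ha, mul_zero]
  rwa [htop, Submodule.top_orthogonal_eq_bot, Submodule.mem_bot] at this

/-- **Euler's inequality for simplices**: the circumradius of a simplex of full dimension `d` is at
least `d` times its inradius, with equality exactly when all edges are equal. -/
theorem AffineIndependent.euler_inequality [Nontrivial ι] [FiniteDimensional ℝ V] {x : ι → V}
    (hx : AffineIndependent ℝ x) (hd : Fintype.card ι = Module.finrank ℝ V + 1)
    {c : V} {R r : ℝ} (hR : ∀ i, dist c (x i) = R) {w : ι → ℝ} (hw0 : ∀ i, 0 ≤ w i)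
    (hw1 : ∑ i, w i = 1)
    (hr : ∀ i, Metric.infDist (∑ j, w j • x j) (affineSpan ℝ (x '' {i}ᶜ) : Set V) = r) :
    0 < r ∧ Module.finrank ℝ V * r ≤ R ∧
      (R = Module.finrank ℝ V * r ↔ ∃ a, ∀ i j, i ≠ j → dist (x i) (x j) = a) := by
  classical
  choose g hg hgw using hx.exists_barycentric_gradient
  have norm_sum : r * ∑ i, ‖g i‖ = 1 := by
    rw [Finset.mul_sum, ← hw1]
    exact Finset.sum_congr rfl fun i _ => by rw [← hr i, hgw i w hw1, abs_of_nonneg (hw0 i)]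
  have sum_nonneg : 0 ≤ ∑ i, ‖g i‖ := Finset.sum_nonneg fun i _ => norm_nonneg _
  have r_pos : 0 < r := by
    by_contra! h
    nlinarith
  obtain ⟨u, norm_u, u_sub⟩ :
      ∃ u : ι → V, (∀ i, ‖u i‖ = R) ∧ ∀ i j, u i - u j = x i - x j :=
    ⟨fun i => x i - c, fun i => by rw [← hR i, dist_comm, dist_eq_norm],
      fun i j => sub_sub_sub_cancel_right _ _ _⟩
  have inner_g (i j : ι) (h : j ≠ i) : ⟪g i, u i⟫ - ⟪g i, u j⟫ = 1 := by
    rw [← inner_sub_right, u_sub, hg i j h]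
  have sum_g : ∑ i, g i = 0 := by
    obtain ⟨k⟩ : Nonempty ι := inferInstance
    refine hx.eq_zero_of_inner_edge_eq_zero hd k fun j hj => ?_
    rw [← u_sub, sum_inner, Finset.sum_eq_add k j hj.symm]
    · rw [inner_sub_right, inner_sub_right, inner_g k j hj]
      linarith [inner_g j k hj.symm]
    · intro i _ h
      rw [inner_sub_right]
      linarith [inner_g i k h.1.symm, inner_g i j h.2.symm]
    · simp
    · simp
  have trace : ∑ i, ⟪g i, u i⟫ = Module.finrank ℝ V := by
    have row (i : ι) : ∑ j, (⟪g i, u i⟫ - ⟪g i, u j⟫) = Module.finrank ℝ V := by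
      rw [← Finset.add_sum_erase _ _ (Finset.mem_univ i),
        Finset.sum_congr rfl fun j hj => inner_g i j (Finset.ne_of_mem_erase hj)]
      simp [hd]
    have total := Finset.sum_congr rfl fun i (_ : i ∈ Finset.univ) => row i
    simp only [Finset.sum_sub_distrib, ← inner_sum, ← sum_inner, sum_g, inner_zero_left,
      Finset.sum_const, Finset.card_univ, sub_zero, nsmul_eq_mul,
      ← Nat.cast_smul_eq_nsmul ℝ (Fintype.card ι) (u _), real_inner_smul_right,
      ← Finset.mul_sum] at total
    exact mul_left_cancel₀ (Nat.cast_ne_zero.mpr Fintype.card_ne_zero) total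
  have cauchy (i : ι) : ⟪g i, u i⟫ ≤ ‖g i‖ * R := norm_u i ▸ real_inner_le_norm _ _
  have sum_cauchy : Module.finrank ℝ V ≤ (∑ i, ‖g i‖) * R := by
    rw [← trace, Finset.sum_mul]
    exact Finset.sum_le_sum fun i _ => cauchy i
  have bound : r * ((∑ i, ‖g i‖) * R) = R := by rw [← mul_assoc, norm_sum, one_mul]
  have eq_iff : R = Module.finrank ℝ V * r ↔ ∀ i, ⟪g i, u i⟫ = ‖g i‖ * R := by
    have : (∀ i, ⟪g i, u i⟫ = ‖g i‖ * R) ↔ (Module.finrank ℝ V : ℝ) = (∑ i, ‖g i‖) * R := by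
      rw [← trace, Finset.sum_mul, Finset.sum_eq_sum_iff_of_le fun i _ => cauchy i]
      simp
    rw [this, ← mul_right_inj' (b := (Module.finrank ℝ V : ℝ)) r_pos.ne', bound, mul_comm r,
      eq_comm]
  have edge_sq (i j : ι) : dist (x i) (x j) ^ 2 = 2 * ⟪u i, u i - u j⟫ := by
    rw [dist_eq_norm, ← u_sub, norm_sub_sq_real, inner_sub_right, real_inner_self_eq_norm_sq,
      norm_u, norm_u]
    ring
  have g_ne (i : ι) : g i ≠ 0 := by
    obtain ⟨j, hj⟩ := exists_ne i
    intro h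
    simpa [h] using hg i j hj
  have R_pos : 0 < R := by
    obtain ⟨i, j, hij⟩ := exists_pair_ne ι
    refine (norm_u i ▸ norm_nonneg (u i)).lt_of_ne fun h => hij (hx.injective ?_)
    rw [← sub_eq_zero, ← u_sub, norm_eq_zero.mp ((norm_u i).trans h.symm),
      norm_eq_zero.mp ((norm_u j).trans h.symm), sub_zero]
  refine ⟨r_pos, by nlinarith, eq_iff.trans ⟨fun h => ?_, ?_⟩⟩
  · have parallel (i : ι) : R • g i = ‖g i‖ • u i := by
      have := (inner_eq_norm_mul_iff_real (x := g i) (y := u i)).mp (by rw [h i, norm_u])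
      rwa [norm_u] at this
    have edge (i j : ι) (hij : i ≠ j) : ‖g i‖ * dist (x i) (x j) ^ 2 = 2 * R := by
      rw [edge_sq, u_sub, mul_left_comm, ← real_inner_smul_left, ← parallel, real_inner_smul_left,
        hg i j hij.symm, mul_one]
    have dist_pos (i j : ι) (hij : i ≠ j) : 0 < dist (x i) (x j) :=
      dist_pos.mpr (hx.injective.ne hij)
    have norm_eq (i j : ι) : ‖g i‖ = ‖g j‖ := by
      by_cases hij : i = j
      · rw [hij]
      · refine mul_right_cancel₀ (pow_pos (dist_pos i j hij) 2).ne' ?_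
        rw [edge i j hij, dist_comm, edge j i (Ne.symm hij)]
    obtain ⟨k, l, hkl⟩ := exists_pair_ne ι
    refine ⟨dist (x k) (x l), fun i j hij => ?_⟩
    refine (pow_left_inj₀ dist_nonneg dist_nonneg two_ne_zero).mp ?_
    refine mul_left_cancel₀ (norm_ne_zero_iff.mpr (g_ne k)) ?_
    rw [edge k l hkl, norm_eq k i, edge i j hij]
  · rintro ⟨a, ha⟩ i
    have scaled : (a ^ 2 / 2) • g i = u i := by
      rw [← sub_eq_zero]
      refine hx.eq_zero_of_inner_edge_eq_zero hd i fun j hj => ?_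
      have := edge_sq i j
      rw [ha i j hj.symm, u_sub] at this
      rw [inner_sub_left, real_inner_smul_left, hg i j hj]
      linarith
    rw [← norm_u i, ← scaled, real_inner_smul_right, norm_smul, real_inner_self_eq_norm_sq,
      Real.norm_of_nonneg (by positivity)]
    ring

end Simplex

theorem exists_weights_of_mem_convexHull_quadruple {E : Type*} [AddCommGroup E] [Module ℝ E]
    {x : Fin 4 → E} {z : E} (hz : z ∈ convexHull ℝ {x 0, x 1, x 2, x 3}) :
    ∃ w : Fin 4 → ℝ, (∀ i, 0 ≤ w i) ∧ ∑ i, w i = 1 ∧ ∑ i, w i • x i = z := by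
  simp only [convexHull_insert, Set.insert_nonempty, Set.singleton_nonempty, convexHull_singleton,
    mem_convexJoin, Set.mem_singleton_iff, exists_eq_left, segment, Set.mem_ofPred_eq] at hz
  obtain ⟨_, ⟨_, ⟨a, b, ha, hb, hab, rfl⟩, c, d, hc, hd, hcd, rfl⟩, e, f, he, hf, hef, rfl⟩ := hz
  refine ⟨![e, f * c, f * (d * a), f * (d * b)], ?_, ?_, ?_⟩
  · simp only [Fin.forall_fin_succ, Fin.forall_fin_zero]
    exact ⟨he, mul_nonneg hf hc, mul_nonneg hf (mul_nonneg hd ha),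
      mul_nonneg hf (mul_nonneg hd hb), trivial⟩
  · simp only [Fin.sum_univ_four, Matrix.cons_val]
    linear_combination f * d * hab + f * hcd + hef
  · simp only [Fin.sum_univ_four, Matrix.cons_val]
    module

/-- For a nondegenerate tetrahedron in `ℝ³` with circumradius `R` and inradius `r`, one has
`R ≥ 3r` (i.e. the radius ratio `μ = R/(3r)` satisfies `μ ≥ 1`), with `μ = 1` if and only
if the tetrahedron is regular (all six edges have equal length). -/
theorem radius_ratio_ge_one_tet
    (x0 x1 x2 x3 : E3) (R r : ℝ)
    (hnd : AffineIndependent ℝ ![x0, x1, x2, x3])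
    (hR : IsCircumradius3 x0 x1 x2 x3 R)
    (hr : IsInradius3 x0 x1 x2 x3 r) :
    3 * r ≤ R ∧
    (R / (3 * r) = 1 ↔
      (dist x0 x1 = dist x0 x2 ∧ dist x0 x2 = dist x0 x3 ∧ dist x0 x3 = dist x1 x2 ∧
        dist x1 x2 = dist x1 x3 ∧ dist x1 x3 = dist x2 x3)) := by
  obtain ⟨c, hc⟩ := hR
  obtain ⟨z, hz, h0, h1, h2, h3⟩ := hr
  obtain ⟨w, hw0, hw1, rfl⟩ :=
    exists_weights_of_mem_convexHull_quadruple (x := ![x0, x1, x2, x3]) hz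
  have faces : ∀ i, Metric.infDist (∑ j, w j • ![x0, x1, x2, x3] j)
      (affineSpan ℝ (![x0, x1, x2, x3] '' {i}ᶜ) : Set E3) = r := by
    have c0 : ({0}ᶜ : Set (Fin 4)) = {1, 2, 3} := by ext i; fin_cases i <;> simp
    have c1 : ({1}ᶜ : Set (Fin 4)) = {0, 2, 3} := by ext i; fin_cases i <;> simp
    have c2 : ({2}ᶜ : Set (Fin 4)) = {0, 1, 3} := by ext i; fin_cases i <;> simp
    have c3 : ({3}ᶜ : Set (Fin 4)) = {0, 1, 2} := by ext i; fin_cases i <;> simp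
    simp only [Fin.forall_fin_succ, Fin.forall_fin_zero]
    refine ⟨?_, ?_, ?_, ?_, trivial⟩
    · simpa [c0, Set.image_insert_eq] using h0
    · simpa [c1, Set.image_insert_eq] using h1
    · simpa [c2, Set.image_insert_eq] using h2
    · simpa [c3, Set.image_insert_eq] using h3
  obtain ⟨r_pos, hle, heq⟩ := hnd.euler_inequality (c := c) (R := R) (by simp)
    (by simpa [Fin.forall_fin_succ] using hc) hw0 hw1 faces
  rw [finrank_euclideanSpace_fin, Nat.cast_ofNat] at hle heq
  refine ⟨hle, ?_⟩
  rw [div_eq_one_iff_eq (by positivity), heq]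
  constructor
  · rintro ⟨a, ha⟩
    have e01 := ha 0 1 (by decide)
    have e02 := ha 0 2 (by decide)
    have e03 := ha 0 3 (by decide)
    have e12 := ha 1 2 (by decide)
    have e13 := ha 1 3 (by decide)
    have e23 := ha 2 3 (by decide)
    simp_all
  · rintro ⟨e1, e2, e3, e4, e5⟩
    refine ⟨dist x0 x1, fun i j hij => ?_⟩
    fin_cases i <;> fin_cases j <;> simp_all [dist_comm]
end
end
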